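/- arXiv:2406.04925 — 2 statements merged into one kernel-verified Lean document; each statement's English description precedes it below -/
import Mathlib

section
/- Let M and N be R-modules and b: M × M → N an R-bilinear symmetric map whose image generates N. Define Stem(b) = (M/Rad(b)) ⊕ N with product (m₁,n₁)·(m₂,n₂) = (0, b(m₁,m₂)) (where Rad(b) = {m ∈ M : b(m,M)=0}). Then Stem(b) is a well-defined commutative associative R-algebra which is 3-nilpotent, and its annihilator equals N, so Stem(b)·Stem(b) = N = Ann(Stem(b)), i.e. Stem(b) is a stem algebra. -/
/-- The radical of a bilinear map `b : M × M → N`. -/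
def bilinRad {R M N : Type*} [CommRing R] [AddCommGroup M] [Module R M]
    [AddCommGroup N] [Module R N] (b : M →ₗ[R] M →ₗ[R] N) : Submodule R M :=
  ⨅ y : M, LinearMap.ker (b.flip y)

theorem mem_bilinRad {R M N : Type*} [CommRing R] [AddCommGroup M] [Module R M]
    [AddCommGroup N] [Module R N] {b : M →ₗ[R] M →ₗ[R] N} {x : M} :
    x ∈ bilinRad b ↔ ∀ y, b x y = 0 := by
  simp [bilinRad]

/-- A symmetric bilinear map descends to the quotient by its radical. -/
theorem exists_bilin_quotient {R M N : Type*} [CommRing R] [AddCommGroup M] [Module R M]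
    [AddCommGroup N] [Module R N] (b : M →ₗ[R] M →ₗ[R] N) (hsymm : ∀ x y : M, b x y = b y x) :
    ∃ c : (M ⧸ bilinRad b) →ₗ[R] (M ⧸ bilinRad b) →ₗ[R] N,
      ∀ x y : M, c (Submodule.Quotient.mk x) (Submodule.Quotient.mk y) = b x y := by
  have h₁ : bilinRad b ≤ LinearMap.ker b := fun x hx =>
    LinearMap.mem_ker.2 (LinearMap.ext (mem_bilinRad.1 hx))
  have h₂ : bilinRad b ≤ LinearMap.ker ((bilinRad b).liftQ b h₁).flip := fun x hx => by
    refine LinearMap.mem_ker.2 (LinearMap.ext fun y => ?_)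
    obtain ⟨y, rfl⟩ := Submodule.Quotient.mk_surjective _ y
    exact (hsymm y x).trans (mem_bilinRad.1 hx y)
  exact ⟨((bilinRad b).liftQ _ h₂).flip, fun _ _ => rfl⟩

/-- `Stem(b) = (M/Rad(b)) ⊕ N` with product
`(m₁,n₁)·(m₂,n₂) = (0, b(m₁,m₂))` is a well-defined commutative associative
3-nilpotent `R`-algebra whose annihilator equals `N` and whose square equals `N`;
in particular it is a stem algebra. -/
theorem stem_of_bilinear {R M N : Type*} [CommRing R] [AddCommGroup M] [Module R M]
    [AddCommGroup N] [Module R N] (b : M →ₗ[R] M →ₗ[R] N)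
    (hsymm : ∀ x y : M, b x y = b y x)
    (hspan : Submodule.span R {n : N | ∃ x y : M, n = b x y} = ⊤) :
    ∃ mul : ((M ⧸ bilinRad b) × N) → ((M ⧸ bilinRad b) × N) → ((M ⧸ bilinRad b) × N),
      -- well-definedness: the product is given by `b` on representatives
      (∀ (m₁ m₂ : M) (n₁ n₂ : N),
          mul (Submodule.Quotient.mk m₁, n₁) (Submodule.Quotient.mk m₂, n₂)
            = (0, b m₁ m₂)) ∧
      -- `R`-bilinearity
      (∀ x y z, mul (x + y) z = mul x z + mul y z) ∧
      (∀ x y z, mul x (y + z) = mul x y + mul x z) ∧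
      (∀ (r : R) x y, mul (r • x) y = r • mul x y) ∧
      (∀ (r : R) x y, mul x (r • y) = r • mul x y) ∧
      -- commutative and associative
      (∀ x y, mul x y = mul y x) ∧
      (∀ x y z, mul (mul x y) z = mul x (mul y z)) ∧
      -- 3-nilpotent
      (∀ x y z, mul (mul x y) z = 0) ∧
      -- the annihilator is exactly `0 ⊕ N`
      ({x : (M ⧸ bilinRad b) × N | ∀ y, mul x y = 0}
        = ((Submodule.prod (⊥ : Submodule R (M ⧸ bilinRad b)) (⊤ : Submodule R N) :
            Submodule R ((M ⧸ bilinRad b) × N)) : Set ((M ⧸ bilinRad b) × N))) ∧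
      -- the square is exactly `0 ⊕ N`, so `Stem(b)·Stem(b) = N = Ann(Stem(b))`
      (Submodule.span R {z : (M ⧸ bilinRad b) × N | ∃ x y, z = mul x y}
        = Submodule.prod (⊥ : Submodule R (M ⧸ bilinRad b)) (⊤ : Submodule R N)) := by
  obtain ⟨c, hc⟩ := exists_bilin_quotient b hsymm
  refine ⟨fun x y => (0, c x.1 y.1), ?_, ?_, ?_, ?_, ?_, ?_, ?_, ?_, ?_, ?_⟩
  · intro m₁ m₂ _ _
    simp only [hc]
  · intro x y z
    simp
  · intro x y z
    simp
  · intro r x y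
    simp
  · intro r x y
    simp
  · rintro ⟨x, _⟩ ⟨y, _⟩
    obtain ⟨x, rfl⟩ := Submodule.Quotient.mk_surjective _ x
    obtain ⟨y, rfl⟩ := Submodule.Quotient.mk_surjective _ y
    simp only [hc, hsymm x y]
  · intro x y z
    simp
  · intro x y z
    simp
  · ext ⟨x, n⟩
    obtain ⟨x, rfl⟩ := Submodule.Quotient.mk_surjective _ x
    simp only [Set.mem_ofPred_eq, SetLike.mem_coe, Submodule.mem_prod, Submodule.mem_bot,
      Submodule.mem_top, and_true, Submodule.Quotient.mk_eq_zero, mem_bilinRad]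
    constructor
    · intro h y
      rw [← hc]
      exact congrArg Prod.snd (h (Submodule.Quotient.mk y, 0))
    · rintro h ⟨y, _⟩
      obtain ⟨y, rfl⟩ := Submodule.Quotient.mk_surjective _ y
      simp only [hc, h, Prod.mk_zero_zero]
  · apply le_antisymm
    · rw [Submodule.span_le]
      rintro _ ⟨x, y, rfl⟩
      simp
    · have hmap : Submodule.prod (⊥ : Submodule R (M ⧸ bilinRad b)) (⊤ : Submodule R N)
          = (⊤ : Submodule R N).map (LinearMap.inr R (M ⧸ bilinRad b) N) :=
        (Submodule.map_inr _).symm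
      rw [hmap, ← hspan, Submodule.map_span, Submodule.span_le]
      rintro _ ⟨_, ⟨x, y, rfl⟩, rfl⟩
      refine Submodule.subset_span
        ⟨(Submodule.Quotient.mk x, 0), (Submodule.Quotient.mk y, 0), ?_⟩
      simp only [hc, LinearMap.inr_apply]
end

section
/- If two symmetric maximal-rank matrices Θ₁, Θ₂ over ℤ_p are congruent (i.e. A Θ₁ Aᵗ = Θ₂ for some unimodular A), then the associated commutative, torsion-free, 3-nilpotent ℤ_p-algebras with cyclic annihilator are isomorphic. -/
open Matrix

/-- The product on `ℤ_p^n` defined by a symmetric `(n−1)×(n−1)` matrix `Θ`: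
`x·y = (π(x) Θ π(y)ᵗ) e_n`, where `π` projects onto the first `n−1` coordinates. -/
noncomputable def mulOf {p n : ℕ} [Fact p.Prime] (hn : 0 < n)
    (Θ : Matrix (Fin (n - 1)) (Fin (n - 1)) ℤ_[p])
    (x y : Fin n → ℤ_[p]) : Fin n → ℤ_[p] :=
  (∑ i : Fin (n - 1), ∑ j : Fin (n - 1),
      x (Fin.castLE (n.sub_le 1) i) * Θ i j * y (Fin.castLE (n.sub_le 1) j)) •
    (Pi.single (⟨n - 1, Nat.sub_lt hn Nat.one_pos⟩ : Fin n) (1 : ℤ_[p]) :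
      Fin n → ℤ_[p])

/-- Extend a linear automorphism of `R^m` to `R^(m+1)` by the identity on the last coordinate. -/
def snocExtend {R : Type*} [CommRing R] {m : ℕ} (g : (Fin m → R) ≃ₗ[R] (Fin m → R)) :
    (Fin (m + 1) → R) ≃ₗ[R] (Fin (m + 1) → R) where
  toFun x := Fin.snoc (α := fun _ => R) (g (Fin.init x)) (x (Fin.last m))
  invFun x := Fin.snoc (α := fun _ => R) (g.symm (Fin.init x)) (x (Fin.last m))
  map_add' x y := by
    have h : Fin.init (x + y) = (Fin.init x + Fin.init y : Fin m → R) := rfl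
    ext i
    refine Fin.lastCases ?_ (fun j => ?_) i <;> simp [h]
  map_smul' c x := by
    have h : Fin.init (c • x) = (c • Fin.init x : Fin m → R) := rfl
    ext i
    refine Fin.lastCases ?_ (fun j => ?_) i <;> simp [h]
  left_inv x := by simp
  right_inv x := by simp

theorem snocExtend_apply {R : Type*} [CommRing R] {m : ℕ}
    (g : (Fin m → R) ≃ₗ[R] (Fin m → R)) (x : Fin (m + 1) → R) :
    snocExtend g x = Fin.snoc (α := fun _ => R) (g (Fin.init x)) (x (Fin.last m)) :=
  rfl

theorem init_snocExtend {R : Type*} [CommRing R] {m : ℕ}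
    (g : (Fin m → R) ≃ₗ[R] (Fin m → R)) (x : Fin (m + 1) → R) :
    (Fin.init (snocExtend g x) : Fin m → R) = g (Fin.init x) := by
  simp [snocExtend_apply]

theorem snocExtend_single_last {R : Type*} [CommRing R] {m : ℕ}
    (g : (Fin m → R) ≃ₗ[R] (Fin m → R)) (c : R) :
    snocExtend g (Pi.single (Fin.last m) c) = Pi.single (Fin.last m) c := by
  have h : (Fin.init (Pi.single (Fin.last m) c : Fin (m + 1) → R) : Fin m → R) = 0 := by
    ext i
    simp [Fin.init]
  ext i
  refine Fin.lastCases ?_ (fun j => ?_) i <;> simp [snocExtend_apply, h]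

theorem mulOf_succ {p m : ℕ} [Fact p.Prime] (hn : 0 < m + 1)
    (Θ : Matrix (Fin m) (Fin m) ℤ_[p]) (x y : Fin (m + 1) → ℤ_[p]) :
    mulOf hn Θ x y =
      Pi.single (Fin.last m) ((Fin.init x : Fin m → ℤ_[p]) ⬝ᵥ Θ *ᵥ Fin.init y) := by
  have h : mulOf hn Θ x y = (∑ i : Fin m, ∑ j : Fin m, x i.castSucc * Θ i j * y j.castSucc) •
      (Pi.single (Fin.last m) (1 : ℤ_[p]) : Fin (m + 1) → ℤ_[p]) := rfl
  rw [h, ← Pi.single_smul, smul_eq_mul, mul_one]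
  simp only [dotProduct, mulVec, Finset.mul_sum, mul_assoc, Fin.init]

/-- Right multiplication of row vectors by an invertible matrix preserves the forms of a
congruence. -/
theorem vecMul_dotProduct_congr {R ι : Type*} [CommRing R] [Fintype ι] [DecidableEq ι]
    (A B Θ : Matrix ι ι R) (hBA : B * A = 1) (u v : ι → R) :
    (u ᵥ* B) ⬝ᵥ (A * Θ * Aᵀ) *ᵥ (v ᵥ* B) = u ⬝ᵥ Θ *ᵥ v := by
  have h : B * (A * Θ * Aᵀ) * Bᵀ = Θ := by
    calc B * (A * Θ * Aᵀ) * Bᵀ = (B * A) * Θ * (B * A)ᵀ := by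
          simp only [transpose_mul, Matrix.mul_assoc]
      _ = Θ := by simp [hBA]
  rw [← mulVec_transpose B v, mulVec_mulVec, ← dotProduct_mulVec, mulVec_mulVec,
    ← Matrix.mul_assoc, h]

/-- if `Θ₁` and `Θ₂` are congruent (`A Θ₁ Aᵗ = Θ₂` with `A`
unimodular), then the associated algebras are isomorphic. -/
theorem isomorphic_of_congruent {p n : ℕ} [Fact p.Prime] (hp : p ≠ 2) (hn : 0 < n)
    (Θ₁ Θ₂ : Matrix (Fin (n - 1)) (Fin (n - 1)) ℤ_[p])
    (h₁symm : Θ₁.IsSymm) (h₂symm : Θ₂.IsSymm)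
    (h₁rank : ∀ v : Fin (n - 1) → ℤ_[p], Θ₁.mulVec v = 0 → v = 0)
    (h₂rank : ∀ v : Fin (n - 1) → ℤ_[p], Θ₂.mulVec v = 0 → v = 0)
    (hcong : ∃ A : Matrix (Fin (n - 1)) (Fin (n - 1)) ℤ_[p],
      IsUnit A.det ∧ A * Θ₁ * Aᵀ = Θ₂) :
    ∃ f : (Fin n → ℤ_[p]) ≃ₗ[ℤ_[p]] (Fin n → ℤ_[p]),
      ∀ x y : Fin n → ℤ_[p], f (mulOf hn Θ₁ x y) = mulOf hn Θ₂ (f x) (f y) := by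
  obtain ⟨m, rfl⟩ : ∃ m, n = m + 1 := ⟨n - 1, (Nat.sub_add_cancel hn).symm⟩
  change Matrix (Fin m) (Fin m) ℤ_[p] at Θ₁ Θ₂
  obtain ⟨A, hA, rfl⟩ := hcong
  change Matrix (Fin m) (Fin m) ℤ_[p] at A
  have hBA : A⁻¹ * A = 1 := nonsing_inv_mul A hA
  have hAB : A * A⁻¹ = 1 := mul_nonsing_inv A hA
  let g : (Fin m → ℤ_[p]) ≃ₗ[ℤ_[p]] (Fin m → ℤ_[p]) :=
    LinearEquiv.ofLinearMap (vecMulLinear A⁻¹) (vecMulLinear A)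
      (LinearMap.ext fun v => by simp [hAB])
      (LinearMap.ext fun v => by simp [hBA])
  have hg : ∀ v, g v = v ᵥ* A⁻¹ := fun _ => rfl
  refine ⟨snocExtend g, fun x y => ?_⟩
  refine (congrArg _ (mulOf_succ hn Θ₁ x y)).trans ?_
  refine Eq.trans ?_ (mulOf_succ hn (A * Θ₁ * Aᵀ) (snocExtend g x) (snocExtend g y)).symm
  rw [snocExtend_single_last, init_snocExtend, init_snocExtend, hg, hg,
    vecMul_dotProduct_congr A A⁻¹ Θ₁ hBA]
end
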